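/- Assume moreover that 𝒞 is a generator for 𝒢(𝒞)^{⊥1}. Then spc(𝒢(𝒞)) is 𝒞-resolving in 𝒜 with 𝒞-proper generator 𝒞; explicitly: (i) for every M∈spc(𝒢(𝒞)) there is a Hom_𝒜(𝒞,−)-exact short exact sequence 0→K→C→M→0 with C∈𝒞 and K∈spc(𝒢(𝒞)); (ii) for every Hom_𝒜(𝒞,−)-exact short exact sequence 0→A_1→A_2→A_3→0 in 𝒜 with A_1,A_3∈spc(𝒢(𝒞)), also A_2∈spc(𝒢(𝒞)); and (iii) for every Hom_𝒜(𝒞,−)-exact short exact sequence 0→A_1→A_2→A_3→0 in 𝒜 with A_2,A_3∈spc(𝒢(𝒞)), also A_1∈spc(𝒢(𝒞)). -/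

import Mathlib

open CategoryTheory CategoryTheory.Limits CategoryTheory.Abelian ZeroObject

universe w t v u

variable {A : Type u} [Category.{v} A] [Abelian A]

/-- `f`, `g` form a short exact sequence `0 ⟶ X ⟶ Y ⟶ Z ⟶ 0` in `A`. -/
def IsSES {X Y Z : A} (f : X ⟶ Y) (g : Y ⟶ Z) : Prop :=
  ∃ hw : f ≫ g = 0, (ShortComplex.mk f g hw).ShortExact

/-- The short exact sequence `0 ⟶ X ⟶ Y ⟶ Z ⟶ 0` remains exact after applying
`Hom_A(C, -)` for every `C` in `𝒞`. -/
def HomLeftExact (𝒞 : A → Prop) {X Y Z : A} (f : X ⟶ Y) (g : Y ⟶ Z) : Prop :=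
  ∀ ⦃C : A⦄, 𝒞 C →
    Function.Injective (fun h : C ⟶ X => h ≫ f) ∧
    Function.Exact (fun h : C ⟶ X => h ≫ f) (fun h : C ⟶ Y => h ≫ g) ∧
    Function.Surjective (fun h : C ⟶ Y => h ≫ g)

/-- The short exact sequence `0 ⟶ X ⟶ Y ⟶ Z ⟶ 0` remains exact after applying
`Hom_A(-, C)` for every `C` in `𝒞`. -/
def HomRightExact (𝒞 : A → Prop) {X Y Z : A} (f : X ⟶ Y) (g : Y ⟶ Z) : Prop :=
  ∀ ⦃C : A⦄, 𝒞 C →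
    Function.Injective (fun h : Z ⟶ C => g ≫ h) ∧
    Function.Exact (fun h : Z ⟶ C => g ≫ h) (fun h : Y ⟶ C => f ≫ h) ∧
    Function.Surjective (fun h : Y ⟶ C => f ≫ h)

/-- `M` belongs to the Gorenstein subcategory `𝒢(𝒞)`: there is an exact sequence
`⋯ ⟶ C_1 ⟶ C_0 ⟶ C^0 ⟶ C^1 ⟶ ⋯` with all terms in `𝒞`, which remains exact after
applying `Hom_A(C,-)` and `Hom_A(-,C)` for every `C ∈ 𝒞`, such that
`M ≅ Im(C_0 ⟶ C^0)`. -/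
def IsGorenstein (𝒞 : A → Prop) (M : A) : Prop :=
  ∃ (X : ℤ → A) (d : ∀ n : ℤ, X n ⟶ X (n + 1)) (hw : ∀ n, d n ≫ d (n + 1) = 0),
    (∀ n, 𝒞 (X n)) ∧
    (∀ n, (ShortComplex.mk (d n) (d (n + 1)) (hw n)).Exact) ∧
    (∀ (n : ℤ) ⦃C : A⦄, 𝒞 C →
      Function.Exact (fun h : C ⟶ X n => h ≫ d n) (fun h : C ⟶ X (n + 1) => h ≫ d (n + 1))) ∧
    (∀ (n : ℤ) ⦃C : A⦄, 𝒞 C →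
      Function.Exact (fun h : X (n + 1 + 1) ⟶ C => d (n + 1) ≫ h)
        (fun h : X (n + 1) ⟶ C => d n ≫ h)) ∧
    Nonempty (M ≅ Limits.image (d 0))

/-- `𝒞` is a full additive subcategory closed under isomorphisms, encoded as a predicate
closed under isomorphisms, containing a zero object and closed under binary biproducts. -/
def IsAdditiveClosed (𝒞 : A → Prop) : Prop :=
  (∀ ⦃X Y : A⦄, (X ≅ Y) → 𝒞 X → 𝒞 Y) ∧ 𝒞 (0 : A) ∧ ∀ ⦃X Y : A⦄, 𝒞 X → 𝒞 Y → 𝒞 (X ⊞ Y)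

/-- `𝒫(A)` is a generator for `𝒞`: for every `C ∈ 𝒞` there is a short exact sequence
`0 ⟶ C' ⟶ P ⟶ C ⟶ 0` with `P` projective and `C' ∈ 𝒞`. -/
def ProjIsGeneratorFor (𝒞 : A → Prop) : Prop :=
  ∀ ⦃C : A⦄, 𝒞 C → ∃ (C' P : A) (f : C' ⟶ P) (g : P ⟶ C),
    Projective P ∧ 𝒞 C' ∧ IsSES f g

section Ext

variable [HasExt.{w} A]

/-- `𝒞` is self-orthogonal: `Ext^i(C, C') = 0` for all `i ≥ 1` and `C, C' ∈ 𝒞`. -/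
def SelfOrthogonal (𝒞 : A → Prop) : Prop :=
  ∀ ⦃C C' : A⦄, 𝒞 C → 𝒞 C' → ∀ i : ℕ, 1 ≤ i → Subsingleton (Abelian.Ext C C' i)

/-- `M ∈ 𝒢(𝒞)^{⊥1}`, i.e. `Ext^1(G, M) = 0` for every `G ∈ 𝒢(𝒞)`. -/
def RightPerp1 (𝒞 : A → Prop) (M : A) : Prop :=
  ∀ ⦃G : A⦄, IsGorenstein 𝒞 G → Subsingleton (Abelian.Ext G M 1)

/-- `f : G ⟶ M` is a special `𝒢(𝒞)`-precover of `M`. -/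
def IsSpecialPrecover (𝒞 : A → Prop) {G M : A} (f : G ⟶ M) : Prop :=
  IsGorenstein 𝒞 G ∧ Epi f ∧ RightPerp1 𝒞 (kernel f) ∧
    ∀ ⦃G' : A⦄, IsGorenstein 𝒞 G' → Function.Surjective (fun h : G' ⟶ G => h ≫ f)

/-- `M` belongs to the special precovered category `spc(𝒢(𝒞))`. -/
def HasSpecialPrecover (𝒞 : A → Prop) (M : A) : Prop :=
  ∃ (G : A) (f : G ⟶ M), IsSpecialPrecover 𝒞 f

/-- `𝒞` is a generator for `𝒢(𝒞)^{⊥1}`. -/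
def GeneratorForPerp (𝒞 : A → Prop) : Prop :=
  ∀ ⦃T : A⦄, RightPerp1 𝒞 T → ∃ (T' C : A) (f : T' ⟶ C) (g : C ⟶ T),
    𝒞 C ∧ RightPerp1 𝒞 T' ∧ IsSES f g

end Ext

namespace IsSES

variable {X Y Z : A} {f : X ⟶ Y} {g : Y ⟶ Z}

lemma zero (h : IsSES f g) : f ≫ g = 0 := h.1

lemma mono (h : IsSES f g) : Mono f := h.2.mono_f

lemma epi (h : IsSES f g) : Epi g := h.2.epi_g

lemma exists_lift (h : IsSES f g) {T : A} (t : T ⟶ Y) (ht : t ≫ g = 0) :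
    ∃ s : T ⟶ X, s ≫ f = t := by
  have := h.mono
  obtain ⟨hw, hS⟩ := h
  exact ⟨hS.exact.lift t ht, hS.exact.lift_f t ht⟩

lemma exists_desc (h : IsSES f g) {T : A} (t : Y ⟶ T) (ht : f ≫ t = 0) :
    ∃ s : Z ⟶ T, g ≫ s = t := by
  have := h.epi
  obtain ⟨hw, hS⟩ := h
  exact ⟨hS.exact.desc t ht, hS.exact.g_desc t ht⟩

lemma of_lift [Mono f] [Epi g] (hw : f ≫ g = 0)
    (h : ∀ ⦃T : A⦄ (t : T ⟶ Y), t ≫ g = 0 → ∃ s : T ⟶ X, s ≫ f = t) : IsSES f g := by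
  refine ⟨hw, ⟨?_⟩⟩
  rw [ShortComplex.exact_iff_exact_up_to_refinements]
  intro T t ht
  obtain ⟨s, hs⟩ := h t ht
  exact ⟨T, 𝟙 T, inferInstance, s, by simpa using hs.symm⟩

lemma op (h : IsSES f g) : IsSES g.op f.op := ⟨by rw [← op_comp, h.zero, op_zero], h.2.op⟩

lemma unop {X Y Z : Aᵒᵖ} {f : X ⟶ Y} {g : Y ⟶ Z} (h : IsSES f g) : IsSES g.unop f.unop :=
  ⟨by rw [← unop_comp, h.zero, unop_zero], h.2.unop⟩

lemma of_desc [Mono f] [Epi g] (hw : f ≫ g = 0)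
    (h : ∀ ⦃T : A⦄ (t : Y ⟶ T), f ≫ t = 0 → ∃ s : Z ⟶ T, g ≫ s = t) : IsSES f g := by
  have hop : IsSES g.op f.op := by
    refine of_lift (by rw [← op_comp, hw, op_zero]) fun T t ht => ?_
    obtain ⟨s, hs⟩ := h t.unop (Quiver.Hom.op_inj (by simpa using ht))
    exact ⟨s.op, by rw [← op_comp, hs, Quiver.Hom.op_unop]⟩
  exact hop.unop

lemma comp_iso (h : IsSES f g) {Z' : A} (e : Z ≅ Z') : IsSES f (g ≫ e.hom) := by
  have := h.mono
  have := h.epi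
  refine of_lift (by rw [reassoc_of% h.zero, zero_comp]) fun T t ht => h.exists_lift t ?_
  rw [← cancel_mono e.hom, Category.assoc, ht, zero_comp]

lemma iso_comp (h : IsSES f g) {X' : A} (e : X' ≅ X) : IsSES (e.hom ≫ f) g := by
  have := h.mono
  have := h.epi
  refine of_lift (by rw [Category.assoc, h.zero, comp_zero]) fun T t ht => ?_
  obtain ⟨s, rfl⟩ := h.exists_lift t ht
  exact ⟨s ≫ e.inv, by simp⟩

lemma kernel_ι (g : Y ⟶ Z) [Epi g] : IsSES (kernel.ι g) g :=
  of_lift (kernel.condition g) fun _ t ht => ⟨kernel.lift g t ht, kernel.lift_ι _ _ _⟩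

lemma biprod_inl_snd (X Z : A) : IsSES (biprod.inl : X ⟶ X ⊞ Z) (biprod.snd : X ⊞ Z ⟶ Z) := by
  refine of_lift biprod.inl_snd fun T t ht => ⟨t ≫ biprod.fst, ?_⟩
  ext <;> simp [ht]

lemma zero_left (X : A) : IsSES (0 : (0 : A) ⟶ X) (𝟙 X) := by
  have : Mono (0 : (0 : A) ⟶ X) := (isZero_zero A).mono _
  exact of_lift zero_comp fun T t ht => ⟨0, by simpa using ht.symm⟩

lemma zero_right (X : A) : IsSES (𝟙 X) (0 : X ⟶ (0 : A)) := by
  have : Epi (0 : X ⟶ (0 : A)) := (isZero_zero A).epi _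
  exact of_lift comp_zero fun T t _ => ⟨t, Category.comp_id t⟩

lemma pullback_snd (h : IsSES f g) {W : A} (w : W ⟶ Z) :
    IsSES (pullback.lift f 0 (by rw [h.zero, zero_comp]) : X ⟶ pullback g w)
      (pullback.snd g w) := by
  have := h.epi
  have := h.mono
  have : Mono (pullback.lift f 0 (by rw [h.zero, zero_comp]) : X ⟶ pullback g w) :=
    mono_of_mono_fac (pullback.lift_fst _ _ _)
  refine of_lift (pullback.lift_snd _ _ _) fun T t ht => ?_
  obtain ⟨s, hs⟩ := h.exists_lift (t ≫ pullback.fst g w) (by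
    rw [Category.assoc, pullback.condition, reassoc_of% ht, zero_comp])
  refine ⟨s, ?_⟩
  ext
  · rw [Category.assoc, pullback.lift_fst, hs]
  · rw [Category.assoc, pullback.lift_snd, comp_zero, ht]

lemma pullback_fst (h : IsSES f g) {W : A} (w : W ⟶ Z) :
    IsSES (pullback.lift 0 f (by rw [h.zero, zero_comp]) : X ⟶ pullback w g)
      (pullback.fst w g) := by
  have := h.epi
  have := h.mono
  have : Mono (pullback.lift 0 f (by rw [h.zero, zero_comp]) : X ⟶ pullback w g) :=
    mono_of_mono_fac (pullback.lift_snd _ _ _)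
  refine of_lift (pullback.lift_fst _ _ _) fun T t ht => ?_
  obtain ⟨s, hs⟩ := h.exists_lift (t ≫ pullback.snd w g) (by
    rw [Category.assoc, ← pullback.condition, reassoc_of% ht, zero_comp])
  refine ⟨s, ?_⟩
  ext
  · rw [Category.assoc, pullback.lift_fst, comp_zero, ht]
  · rw [Category.assoc, pullback.lift_snd, hs]

lemma pushout_inr (h : IsSES f g) {W : A} (w : X ⟶ W) :
    IsSES (pushout.inr f w)
      (pushout.desc g 0 (by rw [h.zero, comp_zero]) : pushout f w ⟶ Z) := by
  have := h.epi
  have := h.mono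
  have : Epi (pushout.desc g 0 (by rw [h.zero, comp_zero]) : pushout f w ⟶ Z) :=
    epi_of_epi_fac (pushout.inl_desc _ _ _)
  refine of_desc (pushout.inr_desc _ _ _) fun T t ht => ?_
  obtain ⟨s, hs⟩ := h.exists_desc (pushout.inl f w ≫ t) (by
    rw [pushout.condition_assoc, ht, comp_zero])
  refine ⟨s, ?_⟩
  ext
  · rw [pushout.inl_desc_assoc, hs]
  · rw [pushout.inr_desc_assoc, zero_comp, ht]

/-- The kernel of a composite of two epimorphisms is an extension of their kernels. -/
lemma exists_comp {K C : A} {i : K ⟶ X} {p : X ⟶ Y} {j : Z ⟶ Y} {q : Y ⟶ C}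
    (h : IsSES i p) (h' : IsSES j q) :
    ∃ (L : A) (k : L ⟶ X) (a : K ⟶ L) (b : L ⟶ Z), IsSES k (p ≫ q) ∧ IsSES a b := by
  have := h.epi
  have := h'.epi
  have := h'.mono
  refine ⟨pullback p j, pullback.fst p j, _, _, ?_, h.pullback_snd j⟩
  refine of_lift (by rw [reassoc_of% pullback.condition, h'.zero, comp_zero]) fun T t ht => ?_
  obtain ⟨s, hs⟩ := h'.exists_lift (t ≫ p) (by rw [Category.assoc, ht])
  exact ⟨pullback.lift t s hs.symm, pullback.lift_fst _ _ _⟩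

/-- The cokernel of a composite of two monomorphisms is an extension of their cokernels. -/
lemma exists_comp' {W C : A} {k : W ⟶ X} {c : X ⟶ C} {a : X ⟶ Y} {b : Y ⟶ Z}
    (h : IsSES k c) (h' : IsSES a b) :
    ∃ (L : A) (l : Y ⟶ L) (r : C ⟶ L) (s : L ⟶ Z), IsSES (k ≫ a) l ∧ IsSES r s := by
  obtain ⟨L, l, r, s, h₁, h₂⟩ := exists_comp h'.op h.op
  exact ⟨L.unop, l.unop, s.unop, r.unop, h₁.unop, h₂.unop⟩

/-- The part of the snake lemma for epimorphisms between short exact sequences. -/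
lemma exists_kernel {X' Y' Z' K₁ K₃ : A} {f' : X' ⟶ Y'} {g' : Y' ⟶ Z'}
    (h : IsSES f g) (h' : IsSES f' g')
    {i₁ : K₁ ⟶ X} {φ₁ : X ⟶ X'} {φ₂ : Y ⟶ Y'} {i₃ : K₃ ⟶ Z} {φ₃ : Z ⟶ Z'}
    (h₁ : IsSES i₁ φ₁) (h₃ : IsSES i₃ φ₃)
    (comm₁ : f ≫ φ₂ = φ₁ ≫ f') (comm₂ : φ₂ ≫ g' = g ≫ φ₃) :
    ∃ (K₂ : A) (i₂ : K₂ ⟶ Y) (a : K₁ ⟶ K₂) (b : K₂ ⟶ K₃), IsSES i₂ φ₂ ∧ IsSES a b := by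
  have := h.mono
  have := h.epi
  have := h'.mono
  have := h₁.mono
  have := h₁.epi
  have := h₃.mono
  have := h₃.epi
  have hφ₂ : Epi φ₂ := by
    rw [Preadditive.epi_iff_cancel_zero]
    intro T t ht
    have h1 : f' ≫ t = 0 := by
      rw [← cancel_epi φ₁, ← reassoc_of% comm₁, ht, comp_zero, comp_zero]
    obtain ⟨s, rfl⟩ := h'.exists_desc t h1
    have h2 : s = 0 := by
      rw [← cancel_epi φ₃, ← cancel_epi g, ← reassoc_of% comm₂, ht, comp_zero, comp_zero]
    rw [h2, comp_zero]
  obtain ⟨a, ha⟩ : ∃ a : K₁ ⟶ kernel φ₂, a ≫ kernel.ι φ₂ = i₁ ≫ f :=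
    (kernel_ι φ₂).exists_lift _ (by
      rw [Category.assoc, comm₁, reassoc_of% h₁.zero, zero_comp])
  obtain ⟨b, hb⟩ : ∃ b : kernel φ₂ ⟶ K₃, b ≫ i₃ = kernel.ι φ₂ ≫ g :=
    h₃.exists_lift _ (by rw [Category.assoc, ← comm₂, kernel.condition_assoc, zero_comp])
  have hma : Mono a := mono_of_mono_fac ha
  have heb : Epi b := by
    rw [epi_iff_surjective_up_to_refinements]
    intro T y
    obtain ⟨T', π, hπ, x, hx⟩ := surjective_up_to_refinements_of_epi g (y ≫ i₃)
    obtain ⟨s, hs⟩ := h'.exists_lift (x ≫ φ₂) (by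
      rw [Category.assoc, comm₂, ← reassoc_of% hx, h₃.zero, comp_zero, comp_zero])
    obtain ⟨T'', π', hπ', r, hr⟩ := surjective_up_to_refinements_of_epi φ₁ s
    obtain ⟨z, hz⟩ := (kernel_ι φ₂).exists_lift (π' ≫ x - r ≫ f) (by
      rw [Preadditive.sub_comp, Category.assoc, Category.assoc, comm₁, ← hs,
        reassoc_of% hr, sub_self])
    refine ⟨T'', π' ≫ π, inferInstance, z, ?_⟩
    rw [← cancel_mono i₃, Category.assoc, Category.assoc, hx, Category.assoc, hb,
      reassoc_of% hz, Preadditive.sub_comp, Category.assoc, Category.assoc, h.zero, comp_zero,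
      sub_zero]
  refine ⟨kernel φ₂, kernel.ι φ₂, a, b, kernel_ι φ₂, ?_⟩
  refine of_lift ?_ fun T t ht => ?_
  · rw [← cancel_mono i₃, Category.assoc, hb, reassoc_of% ha, h.zero, comp_zero, zero_comp]
  · obtain ⟨s, hs⟩ := h.exists_lift (t ≫ kernel.ι φ₂) (by
      rw [Category.assoc, ← hb, reassoc_of% ht, zero_comp])
    obtain ⟨r, rfl⟩ := h₁.exists_lift s (by
      rw [← cancel_mono f', Category.assoc, ← comm₁, reassoc_of% hs, kernel.condition,
        comp_zero, zero_comp])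
    refine ⟨r, ?_⟩
    rw [← cancel_mono (kernel.ι φ₂), Category.assoc, ha, ← hs, Category.assoc]

/-- The part of the snake lemma for monomorphisms between short exact sequences. -/
lemma exists_cokernel {X' Y' Z' Q₁ Q₃ : A} {f' : X' ⟶ Y'} {g' : Y' ⟶ Z'}
    (h : IsSES f g) (h' : IsSES f' g')
    {φ₁ : X ⟶ X'} {p₁ : X' ⟶ Q₁} {φ₂ : Y ⟶ Y'} {φ₃ : Z ⟶ Z'} {p₃ : Z' ⟶ Q₃}
    (h₁ : IsSES φ₁ p₁) (h₃ : IsSES φ₃ p₃)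
    (comm₁ : f ≫ φ₂ = φ₁ ≫ f') (comm₂ : φ₂ ≫ g' = g ≫ φ₃) :
    ∃ (Q₂ : A) (p₂ : Y' ⟶ Q₂) (a : Q₁ ⟶ Q₂) (b : Q₂ ⟶ Q₃), IsSES φ₂ p₂ ∧ IsSES a b := by
  obtain ⟨K, i, a, b, hi, hab⟩ := exists_kernel h'.op h.op h₃.op h₁.op (φ₂ := φ₂.op)
    (by rw [← op_comp, comm₂, op_comp]) (by rw [← op_comp, comm₁, op_comp])
  exact ⟨K.unop, i.unop, b.unop, a.unop, hi.unop, hab.unop⟩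

section Ext

variable [HasExt.{w} A]

instance subsingleton_ext_one_of_projective (P Y : A) [Projective P] :
    Subsingleton (Ext.{w} P Y 1) :=
  Ext.subsingleton_of_projective P Y 0

lemma exists_lift_of_ext (h : IsSES f g) {C : A} [Subsingleton (Ext.{w} C X 1)] (t : C ⟶ Z) :
    ∃ s : C ⟶ Y, s ≫ g = t := by
  obtain ⟨hw, hS⟩ := h
  obtain ⟨x, hx⟩ := Ext.covariant_sequence_exact₃ C hS (Ext.mk₀ t) (zero_add 1)
    (Subsingleton.elim _ _)
  obtain ⟨s, rfl⟩ := Ext.addEquiv₀.symm.surjective x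
  refine ⟨s, Ext.addEquiv₀.symm.injective ?_⟩
  simpa using hx

lemma exists_extension_of_ext (h : IsSES f g) {C : A} [Subsingleton (Ext.{w} Z C 1)]
    (t : X ⟶ C) : ∃ s : Y ⟶ C, f ≫ s = t := by
  obtain ⟨hw, hS⟩ := h
  obtain ⟨x, hx⟩ := Ext.contravariant_sequence_exact₁ hS C (Ext.mk₀ t) (add_zero 1)
    (Subsingleton.elim _ _)
  obtain ⟨s, rfl⟩ := Ext.addEquiv₀.symm.surjective x
  refine ⟨s, Ext.addEquiv₀.symm.injective ?_⟩
  simpa using hx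

lemma subsingleton_ext_middle (h : IsSES f g) {C : A} {n : ℕ} [Subsingleton (Ext.{w} C X n)]
    [Subsingleton (Ext.{w} C Z n)] : Subsingleton (Ext.{w} C Y n) := by
  obtain ⟨hw, hS⟩ := h
  refine subsingleton_of_forall_eq 0 fun y => ?_
  obtain ⟨x, rfl⟩ := Ext.covariant_sequence_exact₂ C hS y (Subsingleton.elim _ _)
  rw [Subsingleton.elim x 0, Ext.zero_comp]

lemma subsingleton_ext_middle' (h : IsSES f g) {C : A} {n : ℕ} [Subsingleton (Ext.{w} X C n)]
    [Subsingleton (Ext.{w} Z C n)] : Subsingleton (Ext.{w} Y C n) := by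
  obtain ⟨hw, hS⟩ := h
  refine subsingleton_of_forall_eq 0 fun y => ?_
  obtain ⟨x, rfl⟩ := Ext.contravariant_sequence_exact₂ hS C y (Subsingleton.elim _ _)
  rw [Subsingleton.elim x 0, Ext.comp_zero]

lemma subsingleton_ext_left (h : IsSES f g) {C : A} {n : ℕ} [Subsingleton (Ext.{w} Y C n)]
    [Subsingleton (Ext.{w} Z C (n + 1))] : Subsingleton (Ext.{w} X C n) := by
  obtain ⟨hw, hS⟩ := h
  refine subsingleton_of_forall_eq 0 fun x => ?_
  obtain ⟨y, rfl⟩ := Ext.contravariant_sequence_exact₁ hS C x (add_comm 1 n)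
    (Subsingleton.elim _ _)
  rw [Subsingleton.elim y 0, Ext.comp_zero]

lemma subsingleton_ext_of_extension (h : IsSES f g) {C : A} [Subsingleton (Ext.{w} Y C 1)]
    (hext : ∀ t : X ⟶ C, ∃ s : Y ⟶ C, f ≫ s = t) : Subsingleton (Ext.{w} Z C 1) := by
  obtain ⟨hw, hS⟩ := h
  refine subsingleton_of_forall_eq 0 fun z => ?_
  obtain ⟨x, rfl⟩ := Ext.contravariant_sequence_exact₃ hS C z (Subsingleton.elim _ _)
    (add_zero 1)
  obtain ⟨t, rfl⟩ := Ext.addEquiv₀.symm.surjective x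
  obtain ⟨s, rfl⟩ := hext t
  have : Ext.addEquiv₀.symm (f ≫ s) = (Ext.mk₀ f).comp (Ext.mk₀ s) (zero_add 0) := by simp
  rw [this]
  exact hS.extClass_comp_assoc _

end Ext

end IsSES

lemma IsSES.homLeftExact {𝒞 : A → Prop} (hP : ∀ ⦃C : A⦄, 𝒞 C → Projective C)
    {X Y Z : A} {f : X ⟶ Y} {g : Y ⟶ Z} (h : IsSES f g) : HomLeftExact 𝒞 f g := fun C hC => by
  have := hP hC
  have := h.mono
  have := h.epi
  refine ⟨fun s t hst => (cancel_mono f).1 hst, fun t => ⟨h.exists_lift t, ?_⟩,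
    fun t => ⟨Projective.factorThru t g, Projective.factorThru_comp t g⟩⟩
  rintro ⟨s, rfl⟩
  change (s ≫ f) ≫ g = 0
  rw [Category.assoc, h.zero, comp_zero]

lemma exists_int_chain {T : Type*} (R : T → T → Prop) (hr : ∀ x, ∃ y, R x y)
    (hl : ∀ y, ∃ x, R x y) (x : T) : ∃ Z : ℤ → T, Z 1 = x ∧ ∀ n, R (Z n) (Z (n + 1)) := by
  choose r hr using hr
  choose l hl using hl
  let Z : ℤ → T := fun n => Int.casesOn n (fun k => r^[k] x) (fun k => l^[k + 1] x)
  have hZ : ∀ n, R (Z n) (Z (n + 1)) := by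
    rintro (k | k)
    · change R (r^[k] x) (r^[k + 1] x)
      rw [Function.iterate_succ_apply']
      exact hr _
    · cases k with
      | zero => exact hl x
      | succ k =>
        change R (l^[k + 1 + 1] x) (l^[k + 1] x)
        rw [Function.iterate_succ_apply']
        exact hl _
  refine ⟨fun n => Z (n - 1), rfl, fun n => ?_⟩
  simpa using hZ (n - 1)

section Gorenstein

variable [HasExt.{w} A] {𝒞 : A → Prop}

lemma projective_of_projIsGeneratorFor (hso : SelfOrthogonal 𝒞) (hgen : ProjIsGeneratorFor 𝒞)
    {C : A} (hC : 𝒞 C) : Projective C := by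
  obtain ⟨C', P, f, g, hP, hC', h⟩ := hgen hC
  have := hso hC hC' 1 le_rfl
  obtain ⟨s, hs⟩ := h.exists_lift_of_ext (𝟙 C)
  exact Retract.projective ⟨s, g, hs⟩

/-- Coinduction principle for `𝒢(𝒞)` when `𝒞` consists of projective objects. -/
lemma isGorenstein_of_class (hP : ∀ ⦃C : A⦄, 𝒞 C → Projective C) (S : A → Prop)
    (hleft : ∀ ⦃M : A⦄, S M → ∃ (M' C : A) (f : M' ⟶ C) (g : C ⟶ M),
      S M' ∧ 𝒞 C ∧ IsSES f g)
    (hright : ∀ ⦃M : A⦄, S M → ∃ (C M' : A) (f : M ⟶ C) (g : C ⟶ M'),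
      S M' ∧ 𝒞 C ∧ IsSES f g)
    (hext : ∀ ⦃M : A⦄, S M → ∀ ⦃C : A⦄, 𝒞 C → Subsingleton (Ext.{w} M C 1))
    {M : A} (hM : S M) : IsGorenstein 𝒞 M := by
  obtain ⟨Z, hZ1, hZ⟩ := exists_int_chain (T := {N : A // S N})
    (fun N N' => ∃ (C : A) (f : N.1 ⟶ C) (g : C ⟶ N'.1), 𝒞 C ∧ IsSES f g)
    (fun N => by
      obtain ⟨C, M', f, g, hM', hC, h⟩ := hright N.2
      exact ⟨⟨M', hM'⟩, C, f, g, hC, h⟩)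
    (fun N => by
      obtain ⟨M', C, f, g, hM', hC, h⟩ := hleft N.2
      exact ⟨⟨M', hM'⟩, C, f, g, hC, h⟩) ⟨M, hM⟩
  choose X i p hX h using hZ
  have hi := fun n => (h n).mono
  have hp := fun n => (h n).epi
  have hlift : ∀ (n : ℤ) ⦃T : A⦄ (t : T ⟶ X (n + 1)), t ≫ p (n + 1) ≫ i (n + 1 + 1) = 0 →
      ∃ s : T ⟶ (Z (n + 1)).1, s ≫ i (n + 1) = t := fun n T t ht =>
    (h (n + 1)).exists_lift t (by
      rw [← cancel_mono (i (n + 1 + 1)), Category.assoc, ht, zero_comp])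
  have hw : ∀ n, (p n ≫ i (n + 1)) ≫ p (n + 1) ≫ i (n + 1 + 1) = 0 := fun n => by
    rw [Category.assoc, reassoc_of% (h (n + 1)).zero, zero_comp, comp_zero]
  refine ⟨X, fun n => p n ≫ i (n + 1), hw, hX, fun n => ?_, fun n C hC => ?_,
    fun n C hC => ?_, ?_⟩
  · rw [ShortComplex.exact_iff_exact_up_to_refinements]
    intro T t ht
    obtain ⟨s, hs⟩ := hlift n t ht
    obtain ⟨T', π, hπ, x, hx⟩ := surjective_up_to_refinements_of_epi (p n) s
    exact ⟨T', π, hπ, x, by simp [← hs, reassoc_of% hx]⟩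
  · intro t
    refine ⟨fun ht => ?_, ?_⟩
    · obtain ⟨s, hs⟩ := hlift n t ht
      have := hP hC
      exact ⟨Projective.factorThru s (p n), by simp [hs]⟩
    · rintro ⟨s, rfl⟩
      simpa using s ≫= hw n
  · intro t
    refine ⟨fun ht => ?_, ?_⟩
    · obtain ⟨k, hk⟩ := (h (n + 1)).exists_desc t (by
        rw [← cancel_epi (p n), comp_zero, ← Category.assoc]
        exact ht)
      have := hext (Z (n + 1 + 1 + 1)).2 hC
      obtain ⟨s, hs⟩ := (h (n + 1 + 1)).exists_extension_of_ext k
      exact ⟨s, by simp [hs, hk]⟩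
    · rintro ⟨s, rfl⟩
      simpa using hw n =≫ s
  · have : StrongEpi (p 0) := strongEpi_of_epi _
    have e : (Z (0 + 1)).1 ≅ Limits.image (p 0 ≫ i (0 + 1)) :=
      image.isoStrongEpiMono (p 0) (i (0 + 1)) rfl
    have hM' : M = (Z (0 + 1)).1 := by rw [zero_add, hZ1]
    exact ⟨eqToIso hM' ≪≫ e⟩

/-- An object of `𝒢(𝒞)` embeds in, and is a quotient of, objects of `𝒞` with cokernel,
resp. kernel, in `𝒢(𝒞)`, and is left `Ext^1`-orthogonal to `𝒞`. -/
lemma IsGorenstein.exists_ses (hP : ∀ ⦃C : A⦄, 𝒞 C → Projective C) {M : A}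
    (hM : IsGorenstein 𝒞 M) :
    (∃ (M' C : A) (f : M' ⟶ C) (g : C ⟶ M), IsGorenstein 𝒞 M' ∧ 𝒞 C ∧ IsSES f g) ∧
    (∃ (C M' : A) (f : M ⟶ C) (g : C ⟶ M'), IsGorenstein 𝒞 M' ∧ 𝒞 C ∧ IsSES f g) ∧
    ∀ ⦃C : A⦄, 𝒞 C → Subsingleton (Ext.{w} M C 1) := by
  obtain ⟨X, d, hw, hX, hd, -, hYon, ⟨e⟩⟩ := hM
  obtain ⟨m, ⟨e⟩⟩ : ∃ m : ℤ, Nonempty (M ≅ Limits.image (d (m + 1))) := by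
    obtain ⟨m, hm⟩ : ∃ m : ℤ, 0 = m + 1 := ⟨-1, by simp⟩
    exact ⟨m, hm ▸ ⟨e⟩⟩
  have hses : ∀ n, IsSES (Limits.image.ι (d n)) (factorThruImage (d (n + 1))) := fun n => by
    have hz : Limits.image.ι (d n) ≫ factorThruImage (d (n + 1)) = 0 := by
      rw [← cancel_epi (factorThruImage (d n)), ← cancel_mono (Limits.image.ι (d (n + 1)))]
      simp [hw n]
    refine IsSES.of_lift hz fun T t ht => ?_
    have hS : (ShortComplex.mk _ _ hz).Exact := by
      rw [ShortComplex.exact_iff_exact_up_to_refinements]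
      intro T t ht
      have ht' : t ≫ d (n + 1) = 0 := by
        have := ht =≫ Limits.image.ι (d (n + 1))
        rwa [Category.assoc, Limits.image.fac, zero_comp] at this
      obtain ⟨T', π, hπ, x, hx⟩ := (hd n).exact_up_to_refinements t ht'
      exact ⟨T', π, hπ, x ≫ factorThruImage (d n), by simpa using hx⟩
    exact ⟨hS.lift t ht, hS.lift_f t ht⟩
  have hextn : ∀ (n : ℤ) ⦃C : A⦄, 𝒞 C → Subsingleton (Ext.{w} (Limits.image (d n)) C 1) := by
    intro n C hC
    obtain ⟨n, rfl⟩ : ∃ m : ℤ, n = m + 1 := ⟨n - 1, by simp⟩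
    obtain ⟨n, rfl⟩ : ∃ m : ℤ, n = m + 1 := ⟨n - 1, by simp⟩
    have := hP (hX (n + 1 + 1))
    refine (hses (n + 1)).subsingleton_ext_of_extension fun t => ?_
    obtain ⟨s, hs⟩ := (hYon n hC (factorThruImage (d (n + 1)) ≫ t)).1 (by
      change d n ≫ factorThruImage (d (n + 1)) ≫ t = 0
      rw [← Limits.image.fac (d n), Category.assoc, reassoc_of% (hses n).zero, zero_comp,
        comp_zero])
    exact ⟨s, by simpa [← cancel_epi (factorThruImage (d (n + 1)))] using hs⟩
  have hG : ∀ n, IsGorenstein 𝒞 (Limits.image (d n)) := fun n =>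
    isGorenstein_of_class hP (fun N => ∃ n, N = Limits.image (d n))
      (by
        rintro _ ⟨n, rfl⟩
        obtain ⟨n, rfl⟩ : ∃ m : ℤ, n = m + 1 := ⟨n - 1, by simp⟩
        exact ⟨_, _, _, _, ⟨n, rfl⟩, hX _, hses n⟩)
      (by
        rintro _ ⟨n, rfl⟩
        exact ⟨_, _, _, _, ⟨n + 1, rfl⟩, hX _, hses n⟩)
      (by
        rintro _ ⟨n, rfl⟩
        exact hextn n) ⟨n, rfl⟩
  refine ⟨⟨_, _, _, _, hG m, hX _, (hses m).comp_iso e.symm⟩,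
    ⟨_, _, _, _, hG _, hX _, (hses (m + 1)).iso_comp e⟩, fun C hC => ?_⟩
  have := hP (hX (m + 1))
  have := hextn (m + 1) hC
  refine ((hses m).comp_iso e.symm).subsingleton_ext_of_extension fun t => ?_
  exact (hses m).exists_extension_of_ext t

/-- An object with one-step resolutions by objects of `𝒢(𝒞)` lies in `𝒢(𝒞)`. -/
lemma isGorenstein_of_ses (hP : ∀ ⦃C : A⦄, 𝒞 C → Projective C) {M M₁ M₂ C₁ C₂ : A}
    {f : M₁ ⟶ C₁} {g : C₁ ⟶ M} {f' : M ⟶ C₂} {g' : C₂ ⟶ M₂}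
    (hM₁ : IsGorenstein 𝒞 M₁) (hM₂ : IsGorenstein 𝒞 M₂) (hC₁ : 𝒞 C₁) (hC₂ : 𝒞 C₂)
    (h : IsSES f g) (h' : IsSES f' g')
    (hext : ∀ ⦃C : A⦄, 𝒞 C → Subsingleton (Ext.{w} M C 1)) : IsGorenstein 𝒞 M := by
  refine isGorenstein_of_class hP (fun N => IsGorenstein 𝒞 N ∨ N = M) ?_ ?_ ?_ (Or.inr rfl)
  · rintro N (hN | rfl)
    · obtain ⟨⟨M', C, f, g, hM', hC, h⟩, -⟩ := hN.exists_ses hP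
      exact ⟨M', C, f, g, Or.inl hM', hC, h⟩
    · exact ⟨_, _, f, g, Or.inl hM₁, hC₁, h⟩
  · rintro N (hN | rfl)
    · obtain ⟨-, ⟨C, M', f, g, hM', hC, h⟩, -⟩ := hN.exists_ses hP
      exact ⟨C, M', f, g, Or.inl hM', hC, h⟩
    · exact ⟨_, _, f', g', Or.inl hM₂, hC₂, h'⟩
  · rintro N (hN | rfl)
    · exact (hN.exists_ses hP).2.2
    · exact hext

lemma isGorenstein_of_mem (hadd : IsAdditiveClosed 𝒞)
    (hP : ∀ ⦃C : A⦄, 𝒞 C → Projective C) {C : A} (hC : 𝒞 C) : IsGorenstein 𝒞 C :=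
  isGorenstein_of_class hP 𝒞
    (fun M hM => ⟨_, M, _, _, hadd.2.1, hM, IsSES.zero_left M⟩)
    (fun M hM => ⟨M, _, _, _, hadd.2.1, hM, IsSES.zero_right M⟩)
    (fun M hM C _ => by have := hP hM; infer_instance) hC

/-- `𝒢(𝒞)` is closed under extensions. -/
lemma IsSES.isGorenstein_middle (hadd : IsAdditiveClosed 𝒞)
    (hP : ∀ ⦃C : A⦄, 𝒞 C → Projective C) {X Y Z : A} {f : X ⟶ Y} {g : Y ⟶ Z}
    (h : IsSES f g) (hX : IsGorenstein 𝒞 X) (hZ : IsGorenstein 𝒞 Z) : IsGorenstein 𝒞 Y := by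
  have hExt : ∀ {X Y Z : A} {f : X ⟶ Y} {g : Y ⟶ Z}, IsSES f g → IsGorenstein 𝒞 X →
      IsGorenstein 𝒞 Z → ∀ ⦃C : A⦄, 𝒞 C → Subsingleton (Ext.{w} Y C 1) := by
    intro X Y Z f g h hX hZ C hC
    have := (hX.exists_ses hP).2.2 hC
    have := (hZ.exists_ses hP).2.2 hC
    exact h.subsingleton_ext_middle'
  refine isGorenstein_of_class hP (fun N => ∃ (X Z : A) (f : X ⟶ N) (g : N ⟶ Z),
    IsGorenstein 𝒞 X ∧ IsGorenstein 𝒞 Z ∧ IsSES f g) ?_ ?_ ?_ ⟨X, Z, f, g, hX, hZ, h⟩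
  · rintro N ⟨X, Z, f, g, hX, hZ, h⟩
    obtain ⟨⟨X', C, u, p, hX', hC, h₁⟩, -⟩ := hX.exists_ses hP
    obtain ⟨⟨Z', D, v, q, hZ', hD, h₃⟩, -⟩ := hZ.exists_ses hP
    have := hP hD
    have := h.epi
    obtain ⟨K, k, a, b, hk, hab⟩ := IsSES.exists_kernel (IsSES.biprod_inl_snd C D) h h₁ h₃
      (φ₂ := biprod.desc (p ≫ f) (Projective.factorThru q g)) (by simp)
      (by ext <;> simp [h.zero])
    exact ⟨K, C ⊞ D, k, _, ⟨X', Z', a, b, hX', hZ', hab⟩, hadd.2.2 hC hD, hk⟩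
  · rintro N ⟨X, Z, f, g, hX, hZ, h⟩
    obtain ⟨-, ⟨C, X', u, p, hX', hC, h₁⟩, -⟩ := hX.exists_ses hP
    obtain ⟨-, ⟨D, Z', v, q, hZ', hD, h₃⟩, -⟩ := hZ.exists_ses hP
    have := (hZ.exists_ses hP).2.2 hC
    obtain ⟨s, hs⟩ := h.exists_extension_of_ext u
    obtain ⟨K, k, a, b, hk, hab⟩ := IsSES.exists_cokernel h (IsSES.biprod_inl_snd C D) h₁ h₃
      (φ₂ := biprod.lift s (g ≫ v)) (by ext <;> simp [hs, reassoc_of% h.zero]) (by simp)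
    exact ⟨C ⊞ D, K, _, k, ⟨X', Z', a, b, hX', hZ', hab⟩, hadd.2.2 hC hD, hk⟩
  · rintro N ⟨X, Z, f, g, hX, hZ, h⟩
    exact hExt h hX hZ

/-- The kernel of an epimorphism from an object of `𝒢(𝒞)` to an object of `𝒞` is in `𝒢(𝒞)`. -/
lemma IsSES.isGorenstein_left (hadd : IsAdditiveClosed 𝒞)
    (hP : ∀ ⦃C : A⦄, 𝒞 C → Projective C) {X Y Z : A} {f : X ⟶ Y} {g : Y ⟶ Z}
    (h : IsSES f g) (hY : IsGorenstein 𝒞 Y) (hZ : 𝒞 Z) : IsGorenstein 𝒞 X := by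
  have := hP hZ
  obtain ⟨⟨Y₁, C, u, p, hY₁, hC, h₁⟩, ⟨D, Y₂, v, q, hY₂, hD, h₂⟩, hYext⟩ := hY.exists_ses hP
  obtain ⟨s, hs⟩ := h.exists_lift_of_ext (𝟙 Z)
  obtain ⟨r, hr⟩ := h.exists_lift (𝟙 Y - g ≫ s) (by simp [hs])
  have := h.mono
  have hfr : f ≫ r = 𝟙 X := by
    rw [← cancel_mono f, Category.assoc, hr]
    simp [reassoc_of% h.zero]
  have hsr : IsSES s r := by
    have : Mono s := mono_of_mono_fac hs
    have : Epi r := epi_of_epi_fac hfr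
    refine IsSES.of_lift ?_ fun T t ht => ⟨t ≫ g, ?_⟩
    · rw [← cancel_mono f, Category.assoc, hr]
      simp [reassoc_of% hs]
    · have := t ≫= hr
      rw [reassoc_of% ht, zero_comp, Preadditive.comp_sub, Category.comp_id] at this
      rw [Category.assoc, ← sub_eq_zero.1 this.symm]
  obtain ⟨L, k, a, b, hk, hab⟩ := h₁.exists_comp hsr
  obtain ⟨L', l, a', b', hl, hab'⟩ := h.exists_comp' h₂
  have hZG := isGorenstein_of_mem hadd hP hZ
  refine isGorenstein_of_ses hP (hab.isGorenstein_middle hadd hP hY₁ hZG)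
    (hab'.isGorenstein_middle hadd hP hZG hY₂) hC hD hk hl fun C hC => ?_
  have := hYext hC
  have : Subsingleton (Ext.{w} Z C (1 + 1)) := Ext.subsingleton_of_projective Z C 1
  exact h.subsingleton_ext_left

lemma IsSES.rightPerp1_middle {X Y Z : A} {f : X ⟶ Y} {g : Y ⟶ Z} (h : IsSES f g)
    (hX : RightPerp1 𝒞 X) (hZ : RightPerp1 𝒞 Z) : RightPerp1 𝒞 Y := fun G hG => by
  have := hX hG
  have := hZ hG
  exact h.subsingleton_ext_middle

lemma rightPerp1_of_mem (hP : ∀ ⦃C : A⦄, 𝒞 C → Projective C) {C : A} (hC : 𝒞 C) :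
    RightPerp1 𝒞 C := fun _ hG => (hG.exists_ses hP).2.2 hC

lemma IsSES.hasSpecialPrecover (hadd : IsAdditiveClosed 𝒞)
    (hP : ∀ ⦃C : A⦄, 𝒞 C → Projective C) {K G M : A} {i : K ⟶ G} {f : G ⟶ M}
    (h : IsSES i f) (hG : IsGorenstein 𝒞 G) (hK : RightPerp1 𝒞 K) :
    HasSpecialPrecover 𝒞 M := by
  have := h.mono
  have := h.epi
  refine ⟨G, f, hG, h.epi, ?_, fun G' hG' t => ?_⟩
  · obtain ⟨s, hs⟩ := (IsSES.kernel_ι f).exists_lift i h.zero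
    have : Mono s := mono_of_mono_fac hs
    have : Epi (0 : kernel f ⟶ (0 : A)) := (isZero_zero A).epi _
    have hs0 : IsSES s (0 : kernel f ⟶ (0 : A)) := by
      refine IsSES.of_lift comp_zero fun T t _ => ?_
      obtain ⟨r, hr⟩ := h.exists_lift (t ≫ kernel.ι f) (by simp)
      exact ⟨r, by rw [← cancel_mono (kernel.ι f), Category.assoc, hs, hr]⟩
    exact hs0.rightPerp1_middle hK (rightPerp1_of_mem hP hadd.2.1)
  · have := hK hG'
    exact h.exists_lift_of_ext t

lemma HasSpecialPrecover.exists_ses {M : A} (hM : HasSpecialPrecover 𝒞 M) :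
    ∃ (K G : A) (i : K ⟶ G) (f : G ⟶ M),
      RightPerp1 𝒞 K ∧ IsGorenstein 𝒞 G ∧ IsSES i f := by
  obtain ⟨G, f, hG, hf, hK, -⟩ := hM
  exact ⟨kernel f, G, _, f, hK, hG, IsSES.kernel_ι f⟩

/-- `𝒞` is a generator for `spc(𝒢(𝒞))`. -/
lemma HasSpecialPrecover.exists_generator (hadd : IsAdditiveClosed 𝒞)
    (hP : ∀ ⦃C : A⦄, 𝒞 C → Projective C) (hCgen : GeneratorForPerp 𝒞) {M : A}
    (hM : HasSpecialPrecover 𝒞 M) :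
    ∃ (K C : A) (f : K ⟶ C) (g : C ⟶ M), 𝒞 C ∧ HasSpecialPrecover 𝒞 K ∧ IsSES f g := by
  obtain ⟨K, G, i, p, hK, hG, h⟩ := hM.exists_ses
  obtain ⟨⟨G', C, u, q, hG', hC, h'⟩, -⟩ := hG.exists_ses hP
  obtain ⟨L, k, a, b, hk, hab⟩ := h'.exists_comp h
  obtain ⟨T, D, j, r, hD, hT, hjr⟩ := hCgen hK
  have := hP hD
  have := hab.epi
  obtain ⟨N, n, c, d, hn, hcd⟩ := IsSES.exists_kernel (IsSES.biprod_inl_snd G' D) hab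
    (IsSES.zero_left G') hjr (φ₂ := biprod.desc a (Projective.factorThru r b)) (by simp)
    (by ext <;> simp [hab.zero])
  have hGD := (IsSES.biprod_inl_snd G' D).isGorenstein_middle hadd hP hG'
    (isGorenstein_of_mem hadd hP hD)
  exact ⟨L, C, k, _, hC, hn.hasSpecialPrecover hadd hP hGD
    (hcd.rightPerp1_middle (rightPerp1_of_mem hP hadd.2.1) hT), hk⟩

/-- `spc(𝒢(𝒞))` is closed under extensions. -/
lemma IsSES.hasSpecialPrecover_middle (hadd : IsAdditiveClosed 𝒞)
    (hP : ∀ ⦃C : A⦄, 𝒞 C → Projective C) {X Y Z : A} {f : X ⟶ Y} {g : Y ⟶ Z}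
    (h : IsSES f g) (hX : HasSpecialPrecover 𝒞 X) (hZ : HasSpecialPrecover 𝒞 Z) :
    HasSpecialPrecover 𝒞 Y := by
  obtain ⟨K₁, G₁, i₁, q₁, hK₁, hG₁, h₁⟩ := hX.exists_ses
  obtain ⟨K₃, G₃, i₃, q₃, hK₃, hG₃, h₃⟩ := hZ.exists_ses
  obtain ⟨⟨G', C, u, p, hG', hC, hup⟩, -⟩ := hG₃.exists_ses hP
  have := hP hC
  have := h.epi
  have hl : Projective.factorThru (p ≫ q₃) g ≫ g = p ≫ q₃ := Projective.factorThru_comp _ _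
  obtain ⟨m, hm⟩ := h.exists_lift (u ≫ Projective.factorThru (p ≫ q₃) g) (by
    rw [Category.assoc, hl, reassoc_of% hup.zero, zero_comp])
  have := hK₁ hG'
  obtain ⟨m', rfl⟩ := h₁.exists_lift_of_ext m
  have hpo := hup.pushout_inr m'
  obtain ⟨K, k, a, b, hk, hab⟩ := hpo.exists_kernel h h₁ h₃
    (φ₂ := pushout.desc (Projective.factorThru (p ≫ q₃) g) (q₁ ≫ f)
      (by rw [← hm, Category.assoc]))
    (pushout.inr_desc _ _ _) (by
      ext
      · rw [pushout.inl_desc_assoc, pushout.inl_desc_assoc, hl]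
      · rw [pushout.inr_desc_assoc, pushout.inr_desc_assoc, Category.assoc, h.zero, comp_zero,
          zero_comp])
  exact hk.hasSpecialPrecover hadd hP (hpo.isGorenstein_middle hadd hP hG₁ hG₃)
    (hab.rightPerp1_middle hK₁ hK₃)

/-- `spc(𝒢(𝒞))` is closed under kernels of epimorphisms. -/
lemma IsSES.hasSpecialPrecover_left (hadd : IsAdditiveClosed 𝒞)
    (hP : ∀ ⦃C : A⦄, 𝒞 C → Projective C) (hCgen : GeneratorForPerp 𝒞)
    {X Y Z : A} {f : X ⟶ Y} {g : Y ⟶ Z} (h : IsSES f g)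
    (hY : HasSpecialPrecover 𝒞 Y) (hZ : HasSpecialPrecover 𝒞 Z) :
    HasSpecialPrecover 𝒞 X := by
  obtain ⟨L, C, l, c, hC, hL, hlc⟩ := hZ.exists_generator hadd hP hCgen
  have hQ := (hlc.pullback_fst g).hasSpecialPrecover_middle hadd hP hL hY
  obtain ⟨K, G, i, p, hK, hG, hip⟩ := hQ.exists_ses
  obtain ⟨G', k, a, b, hk, hab⟩ := hip.exists_comp (h.pullback_snd c)
  exact hab.hasSpecialPrecover hadd hP (hk.isGorenstein_left hadd hP hG hC) hK

end Gorenstein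

/-- if `𝒞` is a generator for `𝒢(𝒞)^{⊥1}`, then `spc(𝒢(𝒞))` is
`𝒞`-resolving in `A` with a `𝒞`-proper generator `𝒞`. -/
theorem stmt_18 [HasExt.{w} A] (𝒞 : A → Prop) (hadd : IsAdditiveClosed 𝒞)
    (hso : SelfOrthogonal 𝒞) (hgen : ProjIsGeneratorFor 𝒞)
    (hCgen : GeneratorForPerp 𝒞) :
    (∀ ⦃M : A⦄, HasSpecialPrecover 𝒞 M →
      ∃ (K C : A) (f : K ⟶ C) (g : C ⟶ M),
        𝒞 C ∧ HasSpecialPrecover 𝒞 K ∧ IsSES f g ∧ HomLeftExact 𝒞 f g) ∧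
    (∀ ⦃A₁ A₂ A₃ : A⦄ (f : A₁ ⟶ A₂) (g : A₂ ⟶ A₃), IsSES f g → HomLeftExact 𝒞 f g →
      HasSpecialPrecover 𝒞 A₁ → HasSpecialPrecover 𝒞 A₃ → HasSpecialPrecover 𝒞 A₂) ∧
    (∀ ⦃A₁ A₂ A₃ : A⦄ (f : A₁ ⟶ A₂) (g : A₂ ⟶ A₃), IsSES f g → HomLeftExact 𝒞 f g →
      HasSpecialPrecover 𝒞 A₂ → HasSpecialPrecover 𝒞 A₃ → HasSpecialPrecover 𝒞 A₁) := by
  have hP : ∀ ⦃C : A⦄, 𝒞 C → Projective C := fun _ hC =>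
    projective_of_projIsGeneratorFor hso hgen hC
  refine ⟨fun M hM => ?_, fun _ _ _ f g h _ h₁ h₃ => h.hasSpecialPrecover_middle hadd hP h₁ h₃,
    fun _ _ _ f g h _ h₂ h₃ => h.hasSpecialPrecover_left hadd hP hCgen h₂ h₃⟩
  obtain ⟨K, C, f, g, hC, hK, h⟩ := hM.exists_generator hadd hP hCgen
  exact ⟨K, C, f, g, hC, hK, h, h.homLeftExact hP⟩
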